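/- Let M be a MOMDP with rewards r: X×A → [0,1]^d, let π be a deterministic stationary policy and let π̂ be any stationary policy. Then for every objective i ∈ [d], |J_i(π) − J_i(π̂)| ≤ (1/(1−γ)²) · Σ_{x ∈ X} ν^π(x) · (1 − π̂(π(x)|x)); in particular, (1−γ)² · ‖J(π) − J(π̂)‖_∞ ≤ Σ_{x ∈ X} ν^π(x) Σ_{a ∈ A} π(a|x) · Pr[π̂ at x does not play a]. -/

import Mathlib

open scoped BigOperators
open Classical

/-- A Multi-Objective Markov Decision Process with finite state space `X`,
finite action space `A`, and `d`-dimensional rewards in `[0,1]^d`. -/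
structure MOMDP (X A : Type) [Fintype X] [Fintype A] (d : ℕ) where
  P : X → A → X → ℝ
  P_nonneg : ∀ x a x', 0 ≤ P x a x'
  P_sum_one : ∀ x a, ∑ x', P x a x' = 1
  disc : ℝ
  disc_nonneg : 0 ≤ disc
  disc_lt_one : disc < 1
  init : X → ℝ
  init_nonneg : ∀ x, 0 ≤ init x
  init_sum_one : ∑ x, init x = 1
  r : X → A → Fin d → ℝ
  r_nonneg : ∀ x a i, 0 ≤ r x a i
  r_le_one : ∀ x a i, r x a i ≤ 1

/-- A stationary (Markov) policy: a map from states to distributions over actions. -/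
def IsPolicy {X A : Type} [Fintype A] (π : X → A → ℝ) : Prop :=
  (∀ x a, 0 ≤ π x a) ∧ ∀ x, ∑ a, π x a = 1

/-- The stochastic policy induced by a deterministic policy `f : X → A`. -/
noncomputable def detPolicy {X A : Type} (f : X → A) : X → A → ℝ :=
  fun x a => if a = f x then 1 else 0

/-- The distribution of the state at time `t` under policy `π`. -/
noncomputable def stateDist {X A : Type} [Fintype X] [Fintype A] {d : ℕ}
    (M : MOMDP X A d) (π : X → A → ℝ) : ℕ → X → ℝ
  | 0 => M.init
  | t + 1 => fun x' => ∑ x, ∑ a, stateDist M π t x * π x a * M.P x a x'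

/-- The expected discounted vector return `J(π)`, componentwise. -/
noncomputable def Jret {X A : Type} [Fintype X] [Fintype A] {d : ℕ}
    (M : MOMDP X A d) (π : X → A → ℝ) (i : Fin d) : ℝ :=
  ∑' t : ℕ, M.disc ^ t * ∑ x, ∑ a, stateDist M π t x * π x a * M.r x a i

/-- Pareto front policy: no stationary policy weakly dominates it in all objectives and
strictly in one. -/
def IsPF {X A : Type} [Fintype X] [Fintype A] {d : ℕ}
    (M : MOMDP X A d) (π : X → A → ℝ) : Prop :=
  ¬ ∃ π' : X → A → ℝ, IsPolicy π' ∧ (∀ i, Jret M π i ≤ Jret M π' i) ∧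
      ∃ j, Jret M π j < Jret M π' j

/-- The discounted state occupancy measure `ν^π`. -/
noncomputable def stateOcc {X A : Type} [Fintype X] [Fintype A] {d : ℕ}
    (M : MOMDP X A d) (π : X → A → ℝ) (x : X) : ℝ :=
  (1 - M.disc) * ∑' t : ℕ, M.disc ^ t * stateDist M π t x

/-- The discounted state-action occupancy measure `μ^π`. -/
noncomputable def occ {X A : Type} [Fintype X] [Fintype A] {d : ℕ}
    (M : MOMDP X A d) (π : X → A → ℝ) (p : X × A) : ℝ :=
  stateOcc M π p.1 * π p.1 p.2

/-- `ε`-approximate Pareto front property for a (randomized) output with expected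
return vector `EJ`. -/
def IsEpsPF {X A : Type} [Fintype X] [Fintype A] {d : ℕ}
    (M : MOMDP X A d) (EJ : Fin d → ℝ) (ε : ℝ) : Prop :=
  ¬ ∃ π : X → A → ℝ, IsPolicy π ∧ (∀ i, ε ≤ Jret M π i - EJ i) ∧
      ∃ j, ε < Jret M π j - EJ j


section helpers
variable {X A : Type} [Fintype X] [Fintype A] {d : ℕ}

lemma stateDist_nonneg (M : MOMDP X A d) (σ : X → A → ℝ) (h0 : ∀ x a, 0 ≤ σ x a) :
    ∀ t x, 0 ≤ stateDist M σ t x := by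
  intro t
  induction t with
  | zero => exact M.init_nonneg
  | succ t ih =>
    intro x
    simp only [stateDist]
    exact Finset.sum_nonneg fun y _ => Finset.sum_nonneg fun a _ =>
      mul_nonneg (mul_nonneg (ih y) (h0 y a)) (M.P_nonneg _ _ _)

lemma stateDist_mono (M : MOMDP X A d) (σ p : X → A → ℝ) (h0 : ∀ x a, 0 ≤ σ x a)
    (h : ∀ x a, σ x a ≤ p x a) :
    ∀ t x, stateDist M σ t x ≤ stateDist M p t x := by
  intro t
  induction t with
  | zero => exact fun x => le_rfl
  | succ t ih =>
    intro x
    simp only [stateDist]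
    refine Finset.sum_le_sum fun y _ => Finset.sum_le_sum fun a _ => ?_
    refine mul_le_mul_of_nonneg_right ?_ (M.P_nonneg _ _ _)
    exact mul_le_mul (ih y) (h y a) (h0 y a)
      ((stateDist_nonneg M σ h0 t y).trans (ih y))

lemma stateDist_mass_succ (M : MOMDP X A d) (σ : X → A → ℝ) (t : ℕ) :
    ∑ x, stateDist M σ (t + 1) x = ∑ x, ∑ a, stateDist M σ t x * σ x a := by
  simp only [stateDist]
  rw [Finset.sum_comm]
  refine Finset.sum_congr rfl fun x _ => ?_
  rw [Finset.sum_comm]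
  refine Finset.sum_congr rfl fun a _ => ?_
  rw [← Finset.mul_sum, M.P_sum_one, mul_one]

lemma policy_sum (M : MOMDP X A d) (p : X → A → ℝ) (hp : IsPolicy p) (t : ℕ) :
    ∑ x, ∑ a, stateDist M p t x * p x a = ∑ x, stateDist M p t x := by
  refine Finset.sum_congr rfl fun x _ => ?_
  rw [← Finset.mul_sum, hp.2, mul_one]

lemma stateDist_mass (M : MOMDP X A d) (p : X → A → ℝ) (hp : IsPolicy p) (t : ℕ) :
    ∑ x, stateDist M p t x = 1 := by
  induction t with
  | zero => exact M.init_sum_one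
  | succ t ih => rw [stateDist_mass_succ, policy_sum M p hp, ih]

lemma stateDist_le_one (M : MOMDP X A d) (p : X → A → ℝ) (hp : IsPolicy p) (t : ℕ) (x : X) :
    stateDist M p t x ≤ 1 := by
  rw [← stateDist_mass M p hp t]
  exact Finset.single_le_sum (fun y _ => stateDist_nonneg M p hp.1 t y) (Finset.mem_univ x)

/-- Expected reward at time `t`. -/
noncomputable def rewAt (M : MOMDP X A d) (p : X → A → ℝ) (i : Fin d) (t : ℕ) : ℝ :=
  ∑ x, ∑ a, stateDist M p t x * p x a * M.r x a i

lemma rewAt_sub (M : MOMDP X A d) (σ p : X → A → ℝ) (h0 : ∀ x a, 0 ≤ σ x a)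
    (hp : IsPolicy p) (h : ∀ x a, σ x a ≤ p x a) (i : Fin d) (t : ℕ) :
    0 ≤ rewAt M p i t - rewAt M σ i t ∧
    rewAt M p i t - rewAt M σ i t ≤ 1 - ∑ x, ∑ a, stateDist M σ t x * σ x a := by
  have key : ∀ x a, stateDist M σ t x * σ x a ≤ stateDist M p t x * p x a := fun x a =>
    mul_le_mul (stateDist_mono M σ p h0 h t x) (h x a) (h0 x a) (stateDist_nonneg M p hp.1 t x)
  have hm : (1 : ℝ) = ∑ x, ∑ a, stateDist M p t x * p x a := by
    rw [policy_sum M p hp, stateDist_mass M p hp]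
  rw [hm]
  simp only [rewAt, ← Finset.sum_sub_distrib]
  constructor
  · refine Finset.sum_nonneg fun x _ => Finset.sum_nonneg fun a _ => ?_
    nlinarith [key x a, M.r_nonneg x a i]
  · refine Finset.sum_le_sum fun x _ => Finset.sum_le_sum fun a _ => ?_
    nlinarith [key x a, M.r_le_one x a i]

lemma summable_disc (M : MOMDP X A d) (u : ℕ → ℝ) (h0 : ∀ t, 0 ≤ u t) (h1 : ∀ t, u t ≤ 1) :
    Summable fun t => M.disc ^ t * u t := by
  refine Summable.of_nonneg_of_le (fun t => mul_nonneg (pow_nonneg M.disc_nonneg t) (h0 t))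
    (fun t => ?_) (summable_geometric_of_lt_one M.disc_nonneg M.disc_lt_one)
  exact mul_le_of_le_one_right (pow_nonneg M.disc_nonneg t) (h1 t)

lemma rewAt_bounds (M : MOMDP X A d) (p : X → A → ℝ) (hp : IsPolicy p) (i : Fin d) (t : ℕ) :
    0 ≤ rewAt M p i t ∧ rewAt M p i t ≤ 1 := by
  have hn : ∀ x a, 0 ≤ stateDist M p t x * p x a := fun x a =>
    mul_nonneg (stateDist_nonneg M p hp.1 t x) (hp.1 x a)
  constructor
  · exact Finset.sum_nonneg fun x _ => Finset.sum_nonneg fun a _ =>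
      mul_nonneg (hn x a) (M.r_nonneg _ _ _)
  · rw [← stateDist_mass M p hp t, ← policy_sum M p hp]
    exact Finset.sum_le_sum fun x _ => Finset.sum_le_sum fun a _ =>
      mul_le_of_le_one_right (hn x a) (M.r_le_one _ _ _)

lemma detPolicy_isPolicy (f : X → A) : IsPolicy (detPolicy f) := by
  refine ⟨fun x a => ?_, fun x => ?_⟩
  · unfold detPolicy; split_ifs <;> norm_num
  · simp [detPolicy]

lemma pol_le_one (p : X → A → ℝ) (hp : IsPolicy p) (x : X) (a : A) : p x a ≤ 1 := by
  rw [← hp.2 x]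
  exact Finset.single_le_sum (fun b _ => hp.1 x b) (Finset.mem_univ a)

lemma gap_bound (M : MOMDP X A d) (f : X → A) (πhat : X → A → ℝ) (hpol : IsPolicy πhat)
    (i : Fin d) :
    (1 - M.disc) ^ 2 * |Jret M (detPolicy f) i - Jret M πhat i|
      ≤ ∑ x, stateOcc M (detPolicy f) x * (1 - πhat x (f x)) := by
  have hdet := detPolicy_isPolicy f
  have hg0 := M.disc_nonneg
  have hg1 := M.disc_lt_one
  set σ : X → A → ℝ := fun x a => detPolicy f x a * πhat x a with hσ
  have h0 : ∀ x a, 0 ≤ σ x a := fun x a => mul_nonneg (hdet.1 x a) (hpol.1 x a)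
  have hd : ∀ x a, σ x a ≤ detPolicy f x a := fun x a =>
    mul_le_of_le_one_right (hdet.1 x a) (pol_le_one _ hpol x a)
  have hh : ∀ x a, σ x a ≤ πhat x a := fun x a =>
    mul_le_of_le_one_left (hpol.1 x a) (pol_le_one _ hdet x a)
  have hσsum : ∀ x, ∑ a, σ x a = πhat x (f x) := fun x => by simp [hσ, detPolicy]
  set q : ℕ → ℝ := fun t => ∑ x, ∑ a, stateDist M σ t x * σ x a with hq
  have hq' : ∀ t, q t = ∑ x, stateDist M σ t x * πhat x (f x) := fun t => by
    simp only [hq, ← Finset.mul_sum, hσsum]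
  set e : ℕ → ℝ := fun t => ∑ x, stateDist M (detPolicy f) t x * (1 - πhat x (f x)) with he
  have hq0 : ∀ t, 0 ≤ q t := fun t => Finset.sum_nonneg fun x _ => Finset.sum_nonneg fun a _ =>
    mul_nonneg (stateDist_nonneg M σ h0 t x) (h0 x a)
  have hu0 : ∀ t, 0 ≤ 1 - q t := fun t =>
    (rewAt_sub M σ _ h0 hdet hd i t).1.trans (rewAt_sub M σ _ h0 hdet hd i t).2
  have he0 : ∀ t, 0 ≤ e t := fun t => Finset.sum_nonneg fun x _ =>
    mul_nonneg (stateDist_nonneg M _ hdet.1 t x) (sub_nonneg.2 (pol_le_one _ hpol x _))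
  have he1 : ∀ t, e t ≤ 1 := fun t => by
    rw [← stateDist_mass M _ hdet t]
    refine Finset.sum_le_sum fun x _ => ?_
    exact mul_le_of_le_one_right (stateDist_nonneg M _ hdet.1 t x)
      (by linarith [hpol.1 x (f x)])
  have hstep : ∀ t, ∑ x, stateDist M σ t x - q t ≤ e t := fun t => by
    rw [hq', ← Finset.sum_sub_distrib]
    refine Finset.sum_le_sum fun x _ => ?_
    have h1 := stateDist_mono M σ _ h0 hd t x
    have h2 := pol_le_one _ hpol x (f x)
    nlinarith
  have hbase : 1 - q 0 ≤ e 0 := by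
    have := hstep 0
    have h1 : ∑ x, stateDist M σ 0 x = 1 := M.init_sum_one
    linarith
  have hsucc : ∀ t, 1 - q (t + 1) ≤ (1 - q t) + e (t + 1) := fun t => by
    have := hstep (t + 1)
    rw [stateDist_mass_succ] at this
    change q t - _ ≤ _ at this
    linarith
  have su := summable_disc M (fun t => 1 - q t) hu0 (fun t => by linarith [hq0 t])
  have se := summable_disc M e he0 he1
  -- sum recursion
  have hU : (1 - M.disc) * ∑' t, M.disc ^ t * (1 - q t) ≤ ∑' t, M.disc ^ t * e t := by
    have su' := (summable_nat_add_iff 1).2 su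
    have se' := (summable_nat_add_iff 1).2 se
    have e1 := su.tsum_eq_zero_add
    have e2 := se.tsum_eq_zero_add
    have : ∑' t, M.disc ^ (t + 1) * (1 - q (t + 1)) ≤
        ∑' t, (M.disc * (M.disc ^ t * (1 - q t)) + M.disc ^ (t + 1) * e (t + 1)) := by
      refine Summable.tsum_le_tsum (fun t => ?_) su' ((su.mul_left _).add se')
      have := mul_le_mul_of_nonneg_left (hsucc t) (pow_nonneg hg0 (t + 1))
      calc _ ≤ _ := this
        _ = _ := by ring
    rw [(su.mul_left _).tsum_add se', tsum_mul_left] at this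
    simp only [pow_zero, one_mul] at e1 e2
    linarith
  have hocc : ∑ x, stateOcc M (detPolicy f) x * (1 - πhat x (f x))
      = (1 - M.disc) * ∑' t, M.disc ^ t * e t := by
    have hs : ∀ x, Summable fun t => M.disc ^ t * stateDist M (detPolicy f) t x := fun x =>
      summable_disc M _ (fun t => stateDist_nonneg M _ hdet.1 t x)
        (fun t => stateDist_le_one M _ hdet t x)
    have : ∀ t, M.disc ^ t * e t = ∑ x, M.disc ^ t * stateDist M (detPolicy f) t x
        * (1 - πhat x (f x)) := fun t => by
      simp only [he, Finset.mul_sum, mul_assoc]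
    simp only [this]
    rw [Summable.tsum_finsetSum (fun x _ => (hs x).mul_right _), Finset.mul_sum]
    refine Finset.sum_congr rfl fun x _ => ?_
    rw [tsum_mul_right, stateOcc, mul_assoc]
  have sd := summable_disc M _ (fun t => (rewAt_bounds M _ hdet i t).1)
    (fun t => (rewAt_bounds M _ hdet i t).2)
  have sh := summable_disc M _ (fun t => (rewAt_bounds M _ hpol i t).1)
    (fun t => (rewAt_bounds M _ hpol i t).2)
  have hJ : |Jret M (detPolicy f) i - Jret M πhat i| ≤ ∑' t, M.disc ^ t * (1 - q t) := by
    have e1 : Jret M (detPolicy f) i = ∑' t, M.disc ^ t * rewAt M (detPolicy f) i t := rfl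
    have e2 : Jret M πhat i = ∑' t, M.disc ^ t * rewAt M πhat i t := rfl
    rw [e1, e2, abs_le]
    constructor
    · rw [neg_le_sub_iff_le_add, ← sd.tsum_add su]
      refine Summable.tsum_le_tsum (fun t => ?_) sh (sd.add su)
      rw [← mul_add]
      refine mul_le_mul_of_nonneg_left ?_ (pow_nonneg hg0 t)
      linarith [(rewAt_sub M σ _ h0 hdet hd i t).1, (rewAt_sub M σ _ h0 hpol hh i t).2]
    · rw [sub_le_iff_le_add, ← su.tsum_add sh]
      refine Summable.tsum_le_tsum (fun t => ?_) sd (su.add sh)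
      rw [← mul_add]
      refine mul_le_mul_of_nonneg_left ?_ (pow_nonneg hg0 t)
      linarith [(rewAt_sub M σ _ h0 hpol hh i t).1, (rewAt_sub M σ _ h0 hdet hd i t).2]
  rw [hocc]
  have h1 : 0 ≤ 1 - M.disc := by linarith
  calc _ ≤ (1 - M.disc) ^ 2 * ∑' t, M.disc ^ t * (1 - q t) :=
        mul_le_mul_of_nonneg_left hJ (sq_nonneg _)
    _ = (1 - M.disc) * ((1 - M.disc) * ∑' t, M.disc ^ t * (1 - q t)) := by ring
    _ ≤ _ := mul_le_mul_of_nonneg_left hU h1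

end helpers

/-- **Behavioral cloning error decomposition.** For a deterministic policy `f` and any
stationary policy `π̂`, each component of the return gap is bounded by
`(1/(1-γ)²)·Σ_x ν^f(x)(1 - π̂(f(x)|x))`; in particular
`(1-γ)²‖J(f) - J(π̂)‖_∞ ≤ Σ_x ν^f(x) Σ_a f(a|x)·Pr[π̂ at x does not play a]`. -/
theorem bc_error_decomposition {X A : Type} [Fintype X] [Fintype A] {d : ℕ}
    (M : MOMDP X A d) (f : X → A) (πhat : X → A → ℝ) (hpol : IsPolicy πhat) :
    (∀ i : Fin d,
      |Jret M (detPolicy f) i - Jret M πhat i|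
        ≤ (1 / (1 - M.disc) ^ 2) * ∑ x, stateOcc M (detPolicy f) x * (1 - πhat x (f x))) ∧
    (1 - M.disc) ^ 2 * ‖(fun i : Fin d => Jret M (detPolicy f) i - Jret M πhat i)‖
      ≤ ∑ x, stateOcc M (detPolicy f) x * ∑ a, detPolicy f x a * (1 - πhat x a) := by
  have hpos : 0 < (1 - M.disc) ^ 2 := pow_pos (by linarith [M.disc_lt_one]) 2
  refine ⟨fun i => ?_, ?_⟩
  · rw [one_div, inv_mul_eq_div, le_div_iff₀ hpos, mul_comm]
    exact gap_bound M f πhat hpol i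
  · have hdet := detPolicy_isPolicy f
    have hs : ∀ x, ∑ a, detPolicy f x a * (1 - πhat x a) = 1 - πhat x (f x) := fun x => by
      simp [detPolicy]
    simp only [hs]
    have hnn : 0 ≤ ∑ x, stateOcc M (detPolicy f) x * (1 - πhat x (f x)) := by
      refine Finset.sum_nonneg fun x _ => mul_nonneg ?_ (sub_nonneg.2 (pol_le_one _ hpol x _))
      exact mul_nonneg (by linarith [M.disc_lt_one]) (tsum_nonneg fun t =>
        mul_nonneg (pow_nonneg M.disc_nonneg t) (stateDist_nonneg M _ hdet.1 t x))
    rw [mul_comm, ← le_div_iff₀ hpos]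
    refine (pi_norm_le_iff_of_nonneg (div_nonneg hnn hpos.le)).2 fun i => ?_
    rw [Real.norm_eq_abs, le_div_iff₀ hpos, mul_comm]
    exact gap_bound M f πhat hpol i
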